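/- Let F ⊆ E be fields of characteristic 2 such that E admits a p-basis ω₁,…,ω_r over F with r ≥ 2, with dual derivations ∂₁,…,∂_r. Let D and D′ be F-linear derivations of the Laurent polynomial ring E[u,u⁻¹] satisfying D(u) = ω_{r−1}⁻¹·(1+u), D(λ) = ∂_{r−1}(λ) + ω_r·ω_{r−1}⁻¹·(u⁻¹+1)·∂_r(λ) + ω_{r−1}⁻¹·Σᵢ₌₁^{r−2} ωᵢ·∂ᵢ(λ) for all λ ∈ E, and D′(u) = ω_r⁻¹·(1+u), D′(λ) = ∂_r(λ) + ω_{r−1}·ω_r⁻¹·(u⁻¹+1)·∂_{r−1}(λ) + ω_r⁻¹·Σᵢ₌₁^{r−2} ωᵢ·∂ᵢ(λ) for all λ ∈ E. Then D(ω_{r−1}·u) = 1, D(ω_r·u) = 0, D(ω_{r−1}·ω_r·u) = ω_r·u, D(ωₖ + ωₖ·u) = 0 for all 1 ≤ k ≤ r−2, D∘D = 0, and D∘D′ = D′∘D. -/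

import Mathlib

/-- A `p`-basis of length `r` of a commutative `F`-algebra `R`: a tuple
`ω : Fin r → R` such that each `ω i ^ p` lies in `F·1` and the induced map
`F[T₁,…,T_r]/(T₁^p − ω₁^p, …, T_r^p − ω_r^p) → R`, `Tᵢ ↦ ωᵢ`, is bijective
(equivalently, `aeval ω` is surjective with kernel the ideal generated by the
`Tᵢ^p − ωᵢ^p`). -/
def IsPBasis (F : Type*) [CommRing F] {R : Type*} [CommRing R] [Algebra F R]
    (p : ℕ) {r : ℕ} (ω : Fin r → R) : Prop :=
  ∃ c : Fin r → F,
    (∀ i, ω i ^ p = algebraMap F R (c i)) ∧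
    Function.Surjective (MvPolynomial.aeval (R := F) ω) ∧
    RingHom.ker (MvPolynomial.aeval (R := F) ω).toRingHom =
      Ideal.span (Set.range fun i => MvPolynomial.X i ^ p - MvPolynomial.C (c i))

open LaurentPolynomial

/-- In characteristic two the square of a derivation is a derivation. -/
def Derivation.sqOfTwoEqZero {F R : Type*} [CommRing F] [CommRing R] [Algebra F R]
    (h2 : (2 : R) = 0) (D : Derivation F R R) : Derivation F R R :=
  Derivation.mk' ((D : R →ₗ[F] R) ∘ₗ (D : R →ₗ[F] R)) fun x y => by
    simp only [LinearMap.comp_apply, Derivation.coeFn_coe, Derivation.leibniz, map_add,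
      smul_eq_mul]
    linear_combination D x * D y * h2

theorem Derivation.sqOfTwoEqZero_apply {F R : Type*} [CommRing F] [CommRing R] [Algebra F R]
    (h2 : (2 : R) = 0) (D : Derivation F R R) (x : R) :
    D.sqOfTwoEqZero h2 x = D (D x) := rfl

/-- A derivation of `E[T;T⁻¹]` vanishing at `T` and at algebra generators of `E` is zero. -/
theorem LaurentPolynomial.derivation_eq_zero {F E ι : Type*} [CommRing F] [CommRing E]
    [Algebra F E] {ω : ι → E} (hω : Function.Surjective (MvPolynomial.aeval (R := F) ω))
    (D : Derivation F (LaurentPolynomial E) (LaurentPolynomial E))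
    (hC : ∀ i, D (C (ω i)) = 0) (hT : D (T 1) = 0) (f : LaurentPolynomial E) :
    D f = 0 := by
  have hCE (x : E) : D (C x) = 0 := by
    obtain ⟨q, rfl⟩ := hω x
    induction q using MvPolynomial.induction_on with
    | C c =>
      have : C (MvPolynomial.aeval ω (MvPolynomial.C c)) =
          algebraMap F (LaurentPolynomial E) c := by
        rw [MvPolynomial.aeval_C]; rfl
      rw [this, Derivation.map_algebraMap]
    | add q₁ q₂ h₁ h₂ => rw [map_add, map_add, map_add, h₁, h₂, add_zero]
    | mul_X q i h => rw [map_mul, map_mul, MvPolynomial.aeval_X, D.leibniz, h, hC]; simp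
  have hTinv : D (T (-1)) = 0 := by
    have h : (T (-1) : LaurentPolynomial E) * T 1 = 1 := by rw [← T_add]; simp
    rw [D.leibniz_of_mul_eq_one h, hT, smul_zero]
  induction f using LaurentPolynomial.induction_on with
  | h_C x => exact hCE x
  | h_add hp hq => rw [map_add, hp, hq, add_zero]
  | h_C_mul_T m x h =>
    rw [T_add, ← mul_assoc, D.leibniz, h, hT, smul_zero, smul_zero, add_zero]
  | h_C_mul_T_Z m x h =>
    rw [sub_eq_add_neg, T_add, ← mul_assoc, D.leibniz, h, hTinv, smul_zero, smul_zero, add_zero]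

/-- In characteristic two, the values of a derivation with `D a = 1`, `D b = b a⁻¹ (u⁻¹ + 1)` and
`D u = a⁻¹ (1 + u)` on the products needed to compute compositions. Here `a'`, `b'`, `v` are the
inverses of `a`, `b`, `u`. -/
theorem Derivation.comp_apply_of_two_eq_zero {F R : Type*} [CommRing F] [CommRing R]
    [Algebra F R] (h2 : (2 : R) = 0) {D : Derivation F R R} {a a' b b' u v : R}
    (ha : a' * a = 1) (hb : b' * b = 1) (hu : v * u = 1)
    (hDa : D a = 1) (hDb : D b = b * a' * (v + 1)) (hDu : D u = a' * (1 + u)) :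
    D (a * b' * (v + 1)) = 0 ∧ D (b * a' * (v + 1)) = 0 ∧ D (a' * (1 + u)) = 0 ∧
      D (b' * (1 + u)) = a' * b' * v * (1 + u) ∧
      ∀ w, D w = a' * w → D (a' * w) = 0 ∧ D (b' * w) = a' * b' * v * w := by
  have h1 : D 1 = 0 := D.map_one_eq_zero
  have hDa' : D a' = -a' ^ 2 := by rw [D.leibniz_of_mul_eq_one ha, hDa]; simp
  have hDb' : D b' = -b' ^ 2 * (b * a' * (v + 1)) := by
    rw [D.leibniz_of_mul_eq_one hb, hDb]; simp
  have hDv : D v = -v ^ 2 * (a' * (1 + u)) := by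
    rw [D.leibniz_of_mul_eq_one hu, hDu]; simp
  refine ⟨?_, ?_, ?_, ?_, fun w hw => ⟨?_, ?_⟩⟩ <;>
    simp only [Derivation.leibniz, map_add, smul_eq_mul, *] <;>
    grind

/-- (Here the length of the `p`-basis is `r = n + 2 ≥ 2`;
`ω_{r−1} = ω ((Fin.last n).castSucc)`, `ω_r = ω (Fin.last (n + 1))`, and the
indices `1 ≤ i ≤ r − 2` are the `i.castSucc.castSucc` for `i : Fin n`.) -/
theorem statement19 (F E : Type*) [Field F] [Field E] [Algebra F E] [CharP F 2]
    (n : ℕ) (ω : Fin (n + 2) → E) (hω : IsPBasis F 2 ω)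
    (der : Fin (n + 2) → Derivation F E E)
    (hder : ∀ i j, der i (ω j) = if i = j then (1 : E) else 0)
    (D D' : Derivation F (LaurentPolynomial E) (LaurentPolynomial E))
    (hDu : D (T 1) = C ((ω ((Fin.last n).castSucc))⁻¹) * (1 + T 1))
    (hDC : ∀ lam : E, D (C lam) =
      C (der ((Fin.last n).castSucc) lam) +
        C (ω (Fin.last (n + 1)) * (ω ((Fin.last n).castSucc))⁻¹) * (T (-1) + 1) *
          C (der (Fin.last (n + 1)) lam) +
        C ((ω ((Fin.last n).castSucc))⁻¹) *
          ∑ i : Fin n, C (ω i.castSucc.castSucc * der i.castSucc.castSucc lam))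
    (hD'u : D' (T 1) = C ((ω (Fin.last (n + 1)))⁻¹) * (1 + T 1))
    (hD'C : ∀ lam : E, D' (C lam) =
      C (der (Fin.last (n + 1)) lam) +
        C (ω ((Fin.last n).castSucc) * (ω (Fin.last (n + 1)))⁻¹) * (T (-1) + 1) *
          C (der ((Fin.last n).castSucc) lam) +
        C ((ω (Fin.last (n + 1)))⁻¹) *
          ∑ i : Fin n, C (ω i.castSucc.castSucc * der i.castSucc.castSucc lam)) :
    D (C (ω ((Fin.last n).castSucc)) * T 1) = 1 ∧
    D (C (ω (Fin.last (n + 1))) * T 1) = 0 ∧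
    D (C (ω ((Fin.last n).castSucc) * ω (Fin.last (n + 1))) * T 1) =
      C (ω (Fin.last (n + 1))) * T 1 ∧
    (∀ i : Fin n, D (C (ω i.castSucc.castSucc) + C (ω i.castSucc.castSucc) * T 1) = 0) ∧
    (∀ f, D (D f) = 0) ∧
    (∀ f, D (D' f) = D' (D f)) := by
  obtain ⟨-, -, hsurj, -⟩ := hω
  have hE : (2 : E) = 0 := by
    rw [← map_ofNat (algebraMap F E) 2, CharTwo.two_eq_zero, map_zero]
  have h2 : (2 : LaurentPolynomial E) = 0 := by
    rw [← map_ofNat (C : E →+* LaurentPolynomial E) 2, hE, map_zero]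
  have hne (i) : ω i ≠ 0 := fun h => by simpa [h] using hder i i
  have hinv (i) : C (ω i)⁻¹ * C (ω i) = (1 : LaurentPolynomial E) := by
    rw [← map_mul, inv_mul_cancel₀ (hne i), map_one]
  have hu : (T (-1) : LaurentPolynomial E) * T 1 = 1 := by rw [← T_add]; simp
  have hlast : (Fin.last n).castSucc ≠ Fin.last (n + 1) := Fin.castSucc_ne_last _
  have hmid (i : Fin n) : i.castSucc.castSucc ≠ (Fin.last n).castSucc := by
    simp
  have hmid' (i : Fin n) : i.castSucc.castSucc ≠ Fin.last (n + 1) := Fin.castSucc_ne_last _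
  have hDa : D (C (ω (Fin.last n).castSucc)) = 1 := by
    simp [hDC, hder, hlast.symm, hmid]
  have hDb : D (C (ω (Fin.last (n + 1)))) =
      C (ω (Fin.last (n + 1))) * C (ω (Fin.last n).castSucc)⁻¹ * (T (-1) + 1) := by
    simp [hDC, hder, hlast, hmid']
  have hDw (i : Fin n) : D (C (ω i.castSucc.castSucc)) =
      C (ω (Fin.last n).castSucc)⁻¹ * C (ω i.castSucc.castSucc) := by
    simp [hDC, hder, (hmid i).symm, (hmid' i).symm, ← map_sum]
  have hD'b : D' (C (ω (Fin.last (n + 1)))) = 1 := by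
    simp [hD'C, hder, hlast, hmid']
  have hD'a : D' (C (ω (Fin.last n).castSucc)) =
      C (ω (Fin.last n).castSucc) * C (ω (Fin.last (n + 1)))⁻¹ * (T (-1) + 1) := by
    simp [hD'C, hder, hlast.symm, hmid]
  have hD'w (i : Fin n) : D' (C (ω i.castSucc.castSucc)) =
      C (ω (Fin.last (n + 1)))⁻¹ * C (ω i.castSucc.castSucc) := by
    simp [hD'C, hder, (hmid i).symm, (hmid' i).symm, ← map_sum]
  have hia := hinv (Fin.last n).castSucc
  have hib := hinv (Fin.last (n + 1))
  obtain ⟨e₁, e₂, e₃, e₄, e₅⟩ :=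
    Derivation.comp_apply_of_two_eq_zero h2 hia hib hu hDa hDb hDu
  obtain ⟨d₁, -, -, d₄, d₅⟩ :=
    Derivation.comp_apply_of_two_eq_zero h2 hib hia hu hD'b hD'a hD'u
  have h1 : D 1 = 0 := D.map_one_eq_zero
  have h1' : D' 1 = 0 := D'.map_one_eq_zero
  refine ⟨?_, ?_, ?_, fun i => ?_, fun f => ?_, fun f => ?_⟩
  · rw [D.leibniz, hDa, hDu, smul_eq_mul, smul_eq_mul]
    grind
  · rw [D.leibniz, hDb, hDu, smul_eq_mul, smul_eq_mul]
    grind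
  · rw [map_mul C, D.leibniz, D.leibniz, hDa, hDb, hDu]
    simp only [smul_eq_mul]
    grind
  · rw [map_add, D.leibniz, hDw, hDu, smul_eq_mul, smul_eq_mul]
    grind
  · refine derivation_eq_zero hsurj (D.sqOfTwoEqZero h2) (fun i => ?_) ?_ f
    · rw [Derivation.sqOfTwoEqZero_apply]
      cases i using Fin.lastCases with
      | last => rw [hDb, e₂]
      | cast i =>
        cases i using Fin.lastCases with
        | last => rw [hDa, h1]
        | cast i => rw [hDw, (e₅ _ (hDw i)).1]
    · rw [Derivation.sqOfTwoEqZero_apply, hDu, e₃]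
  · rw [← sub_eq_zero, ← Derivation.commutator_apply]
    refine derivation_eq_zero hsurj ⁅D, D'⁆ (fun i => ?_) ?_ f
    · rw [Derivation.commutator_apply]
      cases i using Fin.lastCases with
      | last => rw [hDb, hD'b, d₁, h1, sub_zero]
      | cast i =>
        cases i using Fin.lastCases with
        | last => rw [hDa, hD'a, e₁, h1', sub_zero]
        | cast i =>
          rw [hDw, hD'w, (e₅ _ (hDw i)).2, (d₅ _ (hD'w i)).2]
          ring
    · rw [Derivation.commutator_apply, hDu, hD'u, e₄, d₄]
      ring
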